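/- arXiv:2508.19947 — 4 statements merged into one kernel-verified Lean document; each statement's English description precedes it below -/
import Mathlib

section
/- For every integer n ≥ 1, the Laurent series ψ_n(X,Y) ∈ K((t)) is nonzero, has order 1 − n², and has leading coefficient (−1)^{n+1}·n. (That is, the leading term of the Laurent series expansion of the n-th division polynomial at the point at infinity, with respect to the local parameter t = −x/y, is (−1)^{n+1}·n·t^{1−n²}.) -/
open HahnSeries

/-- `f = c tᵉ + O(tᵉ⁺¹)`; the coefficient `c` is allowed to vanish. -/
def HasLeadingTerm {K : Type*} [Field K] (f : LaurentSeries K) (e : ℤ) (c : K) : Prop :=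
  ∃ g : PowerSeries K, f = single e (1 : K) * (g : LaurentSeries K) ∧
    PowerSeries.constantCoeff g = c

namespace HasLeadingTerm

variable {K : Type*} [Field K] {f g : LaurentSeries K} {d e : ℤ} {a b : K}

theorem congr (hf : HasLeadingTerm f d a) (he : d = e) (hc : a = b) : HasLeadingTerm f e b :=
  he ▸ hc ▸ hf

theorem add (hf : HasLeadingTerm f e a) (hg : HasLeadingTerm g e b) :
    HasLeadingTerm (f + g) e (a + b) := by
  obtain ⟨p, rfl, rfl⟩ := hf
  obtain ⟨q, rfl, rfl⟩ := hg
  exact ⟨p + q, by rw [PowerSeries.coe_add, mul_add], map_add _ _ _⟩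

theorem sub (hf : HasLeadingTerm f e a) (hg : HasLeadingTerm g e b) :
    HasLeadingTerm (f - g) e (a - b) := by
  obtain ⟨p, rfl, rfl⟩ := hf
  obtain ⟨q, rfl, rfl⟩ := hg
  exact ⟨p - q, by rw [PowerSeries.coe_sub, mul_sub], map_sub _ _ _⟩

theorem mul (hf : HasLeadingTerm f d a) (hg : HasLeadingTerm g e b) :
    HasLeadingTerm (f * g) (d + e) (a * b) := by
  obtain ⟨p, rfl, rfl⟩ := hf
  obtain ⟨q, rfl, rfl⟩ := hg
  refine ⟨p * q, ?_, map_mul _ _ _⟩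
  rw [PowerSeries.coe_mul, mul_mul_mul_comm, single_mul_single, one_mul]

theorem of_C (a : K) : HasLeadingTerm (C a) 0 a :=
  ⟨PowerSeries.C a, by rw [PowerSeries.coe_C, single_zero_one, one_mul],
    PowerSeries.constantCoeff_C a⟩

theorem one : HasLeadingTerm (1 : LaurentSeries K) 0 1 := by
  simpa using of_C (1 : K)

theorem ofNat (n : ℕ) [n.AtLeastTwo] :
    HasLeadingTerm (ofNat(n) : LaurentSeries K) 0 (ofNat(n) : K) := by
  have := of_C (ofNat(n) : K)
  rwa [map_ofNat] at this

theorem pow (hf : HasLeadingTerm f e a) (n : ℕ) : HasLeadingTerm (f ^ n) (n * e) (a ^ n) := by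
  induction n with
  | zero => simpa using one
  | succ n ih =>
    rw [pow_succ, pow_succ]
    exact (ih.mul hf).congr (by push_cast; ring) rfl

theorem of_lt (hf : HasLeadingTerm f d a) (h : e < d) : HasLeadingTerm f e 0 := by
  obtain ⟨p, rfl, rfl⟩ := hf
  obtain ⟨k, hk⟩ := Int.le.dest h.le
  refine ⟨PowerSeries.X ^ k * p, ?_, ?_⟩
  · rw [PowerSeries.coe_mul, PowerSeries.coe_pow, PowerSeries.coe_X, single_pow, ← mul_assoc,
      single_mul_single, ← hk]
    simp
  · have : k ≠ 0 := by omega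
    simp [this]

theorem add_of_lt (hf : HasLeadingTerm f d a) (hg : HasLeadingTerm g e b) (h : d < e) :
    HasLeadingTerm (f + g) d a :=
  (hf.add (hg.of_lt h)).congr rfl (add_zero a)

theorem coeff_of_lt (hf : HasLeadingTerm f e a) (h : d < e) : f.coeff d = 0 := by
  obtain ⟨p, rfl, rfl⟩ := hf
  rw [coeff_single_mul, one_mul, PowerSeries.coeff_coe, if_pos (by omega)]

theorem coeff_eq (hf : HasLeadingTerm f e a) : f.coeff e = a := by
  obtain ⟨p, rfl, rfl⟩ := hf
  rw [coeff_single_mul, one_mul, PowerSeries.coeff_coe, if_neg (by omega)]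
  simp

theorem ne_zero (hf : HasLeadingTerm f e a) (ha : a ≠ 0) : f ≠ 0 := by
  rintro rfl
  exact ha hf.coeff_eq.symm

theorem order_eq (hf : HasLeadingTerm f e a) (ha : a ≠ 0) : f.order = e := by
  refine le_antisymm (order_le_of_coeff_ne_zero (hf.coeff_eq.symm ▸ ha)) ?_
  by_contra! h
  exact coeff_order_eq_zero.not.mpr (hf.ne_zero ha) (hf.coeff_of_lt h)

theorem inv (hf : HasLeadingTerm f e a) (ha : a ≠ 0) : HasLeadingTerm f⁻¹ (-e) a⁻¹ := by
  have hf₀ := hf.ne_zero ha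
  obtain ⟨p, rfl, rfl⟩ := hf
  refine ⟨p⁻¹, ?_, PowerSeries.constantCoeff_inv p⟩
  refine inv_eq_of_mul_eq_one_right ?_
  rw [mul_mul_mul_comm, single_mul_single, ← PowerSeries.coe_mul, PowerSeries.mul_inv_cancel p ha]
  simp

/-- The leading term of a cofactor, from those of a product and of the other factor. -/
theorem of_mul (hf : HasLeadingTerm f d a) (ha : a ≠ 0) (hfg : HasLeadingTerm (f * g) e b) :
    HasLeadingTerm g (e - d) (b / a) := by
  have := (hf.inv ha).mul hfg
  rw [inv_mul_cancel_left₀ (hf.ne_zero ha)] at this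
  exact this.congr (by ring) (by rw [div_eq_inv_mul])

/-- A series whose product with `tᵏ` is `c + O(t)` has leading term `c t⁻ᵏ`. -/
theorem of_single_pow_mul {k : ℕ} {p : PowerSeries K} {r : LaurentSeries K}
    (hr : HasLeadingTerm r 0 a)
    (h : single (1 : ℤ) (1 : K) ^ k * f = r + single (1 : ℤ) (1 : K) * (p : LaurentSeries K)) :
    HasLeadingTerm f (-k) a := by
  have hp : HasLeadingTerm (single (1 : ℤ) (1 : K) * (p : LaurentSeries K)) 1 _ := ⟨p, rfl, rfl⟩
  have ht : HasLeadingTerm (single (1 : ℤ) (1 : K)) 1 1 := ⟨1, by simp, by simp⟩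
  exact ((ht.pow k).of_mul (by simp) (h ▸ hr.add_of_lt hp one_pos)).congr (by ring) (by simp)

end HasLeadingTerm

/-- A sequence satisfying the division polynomial recurrences whose first terms have the expected
leading terms has the expected leading terms throughout. -/
theorem hasLeadingTerm_of_recurrence {K : Type*} [Field K] [CharZero K] (ψ : ℕ → LaurentSeries K)
    (h₁ : HasLeadingTerm (ψ 1) 0 1) (h₂ : HasLeadingTerm (ψ 2) (-3) (-2))
    (h₃ : HasLeadingTerm (ψ 3) (-8) 3) (h₄ : HasLeadingTerm (ψ 4) (-15) (-4))
    (hodd : ∀ m : ℕ, 2 ≤ m →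
        ψ (2 * m + 1) = ψ (m + 2) * ψ m ^ 3 - ψ (m - 1) * ψ (m + 1) ^ 3)
    (heven : ∀ m : ℕ, 2 ≤ m →
        ψ 2 * ψ (2 * m) = ψ m * (ψ (m + 2) * ψ (m - 1) ^ 2 - ψ (m - 2) * ψ (m + 1) ^ 2))
    (n : ℕ) (hn : 1 ≤ n) :
    HasLeadingTerm (ψ n) (1 - (n : ℤ) ^ 2) ((-1) ^ (n + 1) * (n : K)) := by
  induction n using Nat.strong_induction_on with
  | _ n ih =>
  obtain hn₄ | hn₅ := le_or_gt n 4
  · interval_cases n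
    · exact h₁.congr (by norm_num) (by norm_num)
    · exact h₂.congr (by norm_num) (by norm_num)
    · exact h₃.congr (by norm_num) (by norm_num)
    · exact h₄.congr (by norm_num) (by norm_num)
  obtain ⟨m, rfl | rfl⟩ := n.even_or_odd'
  · obtain ⟨k, rfl⟩ : ∃ k, m = k + 3 := ⟨m - 3, by omega⟩
    have h := heven (k + 3) (by omega)
    rw [show k + 3 - 1 = k + 2 by omega, show k + 3 - 2 = k + 1 by omega] at h
    have hm := ih (k + 3) (by omega) (by omega)
    have hm₂ := ih (k + 3 + 2) (by omega) (by omega)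
    have hm₁ := ih (k + 3 + 1) (by omega) (by omega)
    have hk₂ := ih (k + 2) (by omega) (by omega)
    have hk₁ := ih (k + 1) (by omega) (by omega)
    have hl := hm₂.mul (hk₂.pow 2)
    have hr := (hk₁.mul (hm₁.pow 2)).congr
      (e := 1 - ((k + 3 + 2 : ℕ) : ℤ) ^ 2 + (2 : ℕ) * (1 - ((k + 2 : ℕ) : ℤ) ^ 2))
      (by push_cast; ring) rfl
    have hprod := hm.mul (hl.sub hr)
    rw [← h] at hprod
    refine (h₂.of_mul (by norm_num) hprod).congr (by push_cast; ring) ?_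
    have hs : ((-1 : K) ^ k) ^ 2 = 1 := by rw [← pow_mul, mul_comm, pow_mul]; simp
    have hs' : (-1 : K) ^ (2 * (k + 3) + 1) = -1 := by rw [pow_succ, pow_mul]; simp
    rw [hs', div_eq_iff (by norm_num)]
    push_cast
    simp only [pow_succ (-1 : K)]
    linear_combination ((k : K) + 3) * 4 * (((-1 : K) ^ k) ^ 2 + 1) * hs
  · obtain ⟨k, rfl⟩ : ∃ k, m = k + 2 := ⟨m - 2, by omega⟩
    have h := hodd (k + 2) (by omega)
    rw [show k + 2 - 1 = k + 1 by omega] at h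
    have hm := ih (k + 2) (by omega) (by omega)
    have hm₂ := ih (k + 2 + 2) (by omega) (by omega)
    have hm₁ := ih (k + 2 + 1) (by omega) (by omega)
    have hk₁ := ih (k + 1) (by omega) (by omega)
    have hl := (hm₂.mul (hm.pow 3)).congr (e := 1 - ((2 * (k + 2) + 1 : ℕ) : ℤ) ^ 2)
      (by push_cast; ring) rfl
    have hr := (hk₁.mul (hm₁.pow 3)).congr (e := 1 - ((2 * (k + 2) + 1 : ℕ) : ℤ) ^ 2)
      (by push_cast; ring) rfl
    rw [h]
    refine (hl.sub hr).congr rfl ?_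
    have hs : ((-1 : K) ^ k) ^ 2 = 1 := by rw [← pow_mul, mul_comm, pow_mul]; simp
    have hs' : (-1 : K) ^ (2 * (k + 2) + 1 + 1) = 1 := by
      rw [show 2 * (k + 2) + 1 + 1 = 2 * (k + 3) by ring, pow_mul]; simp
    rw [hs']
    push_cast
    simp only [pow_succ (-1 : K)]
    linear_combination (2 * (k : K) + 5) * (((-1 : K) ^ k) ^ 2 + 1) * hs

/-- **Leading term of division polynomials at infinity.**
Let `K` be a field of characteristic zero, `X Y : K((t))` Laurent series satisfying a Weierstrass
equation with `X = t⁻² + O(t⁻¹)` and `Y = -t⁻³ + O(t⁻²)`, and let `ψ n` denote the evaluation at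
`(X, Y)` of the `n`-th division polynomial of the Weierstrass curve (characterized by the standard
initial values and recurrences).  Then for every `n ≥ 1`, `ψ n` is a nonzero Laurent series of
order `1 - n²` with leading coefficient `(-1)^(n+1) · n`. -/
theorem division_polynomial_leading_term
    {K : Type*} [Field K] [CharZero K]
    (a₁ a₂ a₃ a₄ a₆ b₂ b₄ b₆ b₈ : K)
    (hb₂ : b₂ = a₁ ^ 2 + 4 * a₂)
    (hb₄ : b₄ = 2 * a₄ + a₁ * a₃)
    (hb₆ : b₆ = a₃ ^ 2 + 4 * a₆)
    (hb₈ : b₈ = a₁ ^ 2 * a₆ + 4 * a₂ * a₆ - a₁ * a₃ * a₄ + a₂ * a₃ ^ 2 - a₄ ^ 2)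
    (T X Y : LaurentSeries K)
    (hT : T = HahnSeries.single (1 : ℤ) (1 : K))
    (hW : Y ^ 2 + C a₁ * X * Y + C a₃ * Y
        = X ^ 3 + C a₂ * X ^ 2 + C a₄ * X + C a₆)
    (hX : ∃ f : PowerSeries K, T ^ 2 * X = 1 + T * (f : LaurentSeries K))
    (hY : ∃ g : PowerSeries K, T ^ 3 * Y = -1 + T * (g : LaurentSeries K))
    (ψ : ℕ → LaurentSeries K)
    (hψ₀ : ψ 0 = 0)
    (hψ₁ : ψ 1 = 1)
    (hψ₂ : ψ 2 = 2 * Y + C a₁ * X + C a₃)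
    (hψ₃ : ψ 3 = 3 * X ^ 4 + C b₂ * X ^ 3 + 3 * C b₄ * X ^ 2 + 3 * C b₆ * X + C b₈)
    (hψ₄ : ψ 4 = ψ 2 * (2 * X ^ 6 + C b₂ * X ^ 5 + 5 * C b₄ * X ^ 4 + 10 * C b₆ * X ^ 3
        + 10 * C b₈ * X ^ 2 + C (b₂ * b₈ - b₄ * b₆) * X + C (b₄ * b₈ - b₆ ^ 2)))
    (hψodd : ∀ m : ℕ, 2 ≤ m →
        ψ (2 * m + 1) = ψ (m + 2) * ψ m ^ 3 - ψ (m - 1) * ψ (m + 1) ^ 3)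
    (hψeven : ∀ m : ℕ, 2 ≤ m →
        ψ 2 * ψ (2 * m) = ψ m * (ψ (m + 2) * ψ (m - 1) ^ 2 - ψ (m - 2) * ψ (m + 1) ^ 2)) :
    ∀ n : ℕ, 1 ≤ n →
      ψ n ≠ 0 ∧ (ψ n).order = 1 - (n : ℤ) ^ 2 ∧
        (ψ n).coeff ((ψ n).order) = (-1 : K) ^ (n + 1) * (n : K) := by
  subst hT
  obtain ⟨f, hf⟩ := hX
  obtain ⟨g, hg⟩ := hY
  have hX' : HasLeadingTerm X (-2) 1 := HasLeadingTerm.one.of_single_pow_mul hf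
  have hY' : HasLeadingTerm Y (-3) (-1) :=
    HasLeadingTerm.of_single_pow_mul (by simpa using HasLeadingTerm.of_C (-1 : K)) hg
  have hc := HasLeadingTerm.of_C (K := K)
  have h₂ : HasLeadingTerm (ψ 2) (-3) (-2) := by
    rw [hψ₂]
    exact ((((HasLeadingTerm.ofNat 2).mul hY').add_of_lt ((hc a₁).mul hX') (by norm_num)).add_of_lt
      (hc a₃) (by norm_num)).congr (by norm_num) (by norm_num)
  have h₃ : HasLeadingTerm (ψ 3) (-8) 3 := by
    rw [hψ₃]
    have h3 := HasLeadingTerm.ofNat (K := K) 3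
    exact (((((h3.mul (hX'.pow 4)).add_of_lt ((hc b₂).mul (hX'.pow 3)) (by norm_num)).add_of_lt
      ((h3.mul (hc b₄)).mul (hX'.pow 2)) (by norm_num)).add_of_lt
      ((h3.mul (hc b₆)).mul hX') (by norm_num)).add_of_lt
      (hc b₈) (by norm_num)).congr (by norm_num) (by norm_num)
  have h₄ : HasLeadingTerm (ψ 4) (-15) (-4) := by
    rw [hψ₄]
    have h5 := HasLeadingTerm.ofNat (K := K) 5
    have h10 := HasLeadingTerm.ofNat (K := K) 10
    exact (h₂.mul (((((((((HasLeadingTerm.ofNat 2).mul (hX'.pow 6)).add_of_lt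
      ((hc b₂).mul (hX'.pow 5)) (by norm_num)).add_of_lt
      ((h5.mul (hc b₄)).mul (hX'.pow 4)) (by norm_num)).add_of_lt
      ((h10.mul (hc b₆)).mul (hX'.pow 3)) (by norm_num)).add_of_lt
      ((h10.mul (hc b₈)).mul (hX'.pow 2)) (by norm_num)).add_of_lt
      ((hc (b₂ * b₈ - b₄ * b₆)).mul hX') (by norm_num)).add_of_lt
      (hc (b₄ * b₈ - b₆ ^ 2)) (by norm_num)))).congr (by norm_num) (by norm_num)
  intro n hn
  have h := hasLeadingTerm_of_recurrence ψ (hψ₁ ▸ HasLeadingTerm.one) h₂ h₃ h₄ hψodd hψeven n hn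
  have hne : (-1 : K) ^ (n + 1) * (n : K) ≠ 0 :=
    mul_ne_zero (pow_ne_zero _ (by norm_num)) (Nat.cast_ne_zero.mpr (by omega))
  have hord := h.order_eq hne
  exact ⟨h.ne_zero hne, hord, by rw [hord, h.coeff_eq]⟩
end

section
/- For every integer n ≥ 1, the Laurent series X·ψ_n(X,Y)² − ψ_{n+1}(X,Y)·ψ_{n−1}(X,Y) ∈ K((t)) is nonzero, has order −2n², and has leading coefficient 1. (Equivalently, the x-coordinate of multiplication by n, written via division polynomials, has Laurent expansion at infinity with leading term t^{−2n²}.) -/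
open HahnSeries

/-- A sequence in a domain satisfying the initial values and recurrences of a normalised elliptic
divisibility sequence is given by the auxiliary sequence `preNormEDS'`. -/
lemma eq_preNormEDS'_mul_of_rec {R : Type*} [CommRing R] [IsDomain R] {ψ : ℕ → R} {c d : R}
    (h₀ : ψ 0 = 0) (h₁ : ψ 1 = 1) (h₂ : ψ 2 ≠ 0) (h₃ : ψ 3 = c) (h₄ : ψ 4 = ψ 2 * d)
    (hodd : ∀ m : ℕ, 2 ≤ m →
      ψ (2 * m + 1) = ψ (m + 2) * ψ m ^ 3 - ψ (m - 1) * ψ (m + 1) ^ 3)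
    (heven : ∀ m : ℕ, 2 ≤ m →
      ψ 2 * ψ (2 * m) = ψ m * (ψ (m + 2) * ψ (m - 1) ^ 2 - ψ (m - 2) * ψ (m + 1) ^ 2)) (n : ℕ) :
    ψ n = preNormEDS' (ψ 2 ^ 4) c d n * if Even n then ψ 2 else 1 := by
  induction n using Nat.strong_induction_on with
  | _ n ih =>
    by_cases hn : n < 5
    · interval_cases n
      · simp [h₀]
      · simp [h₁]
      · simp
      · simp [h₃, show ¬Even 3 by decide]
      · simp [h₄, show Even 4 by decide, mul_comm]
    · rcases n.even_or_odd' with ⟨k, rfl | rfl⟩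
      · obtain ⟨m, rfl⟩ : ∃ m, k = m + 3 := ⟨k - 3, by lia⟩
        apply mul_left_cancel₀ h₂
        rw [heven (m + 3) (by lia), if_pos (even_two_mul _), preNormEDS'_even,
          show m + 3 - 1 = m + 2 by lia, show m + 3 - 2 = m + 1 by lia, ih (m + 3) (by lia),
          ih (m + 3 + 2) (by lia), ih (m + 2) (by lia), ih (m + 1) (by lia),
          ih (m + 3 + 1) (by lia)]
        by_cases hm : Even m <;> simp only [hm, Nat.even_add_one, not_true, not_false_iff,
          if_true, if_false] <;> ring
      · obtain ⟨m, rfl⟩ : ∃ m, k = m + 2 := ⟨k - 2, by lia⟩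
        rw [hodd (m + 2) (by lia), if_neg (Nat.not_even_two_mul_add_one _), preNormEDS'_odd,
          show m + 2 - 1 = m + 1 by lia, ih (m + 2) (by lia), ih (m + 2 + 2) (by lia),
          ih (m + 1) (by lia), ih (m + 2 + 1) (by lia)]
        by_cases hm : Even m <;> simp only [hm, Nat.even_add_one, not_true, not_false_iff,
          if_true, if_false] <;> ring

section LaurentEval

variable {K : Type*} [Field K] {X : LaurentSeries K}

/-- A Laurent series of the form `t⁻² + O(t⁻¹)` has order `-2` and leading coefficient `1`. -/
lemma order_eq_neg_two_of_single_sq_mul_eq {f : PowerSeries K}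
    (h : (single (1 : ℤ) (1 : K)) ^ 2 * X = 1 + single (1 : ℤ) (1 : K) * (f : LaurentSeries K)) :
    X.order = -2 ∧ X.leadingCoeff = 1 := by
  have hc (i : ℤ) : X.coeff i =
      (1 + single (1 : ℤ) (1 : K) * (f : LaurentSeries K) : LaurentSeries K).coeff (i + 2) := by
    rw [← h, single_pow, coeff_single_mul]
    simp
  have hlead : X.coeff (-2) = 1 := by
    simp [hc, coeff_single_mul, PowerSeries.coeff_coe]
  have hlt (j : ℤ) (hj : j < -2) : X.coeff j = 0 := by
    rw [hc, coeff_add, coeff_single_mul, PowerSeries.coeff_coe, if_pos (by lia), coeff_one,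
      if_neg (by lia)]
    simp
  have hne : X.coeff (-2) ≠ 0 := by simp [hlead]
  have hord : X.order = -2 :=
    le_antisymm (order_le_of_coeff_ne_zero hne)
      ((le_order_iff_forall (ne_zero_of_coeff_ne_zero hne)).2 hlt)
  exact ⟨hord, by rw [leadingCoeff_eq, hord, hlead]⟩

lemma coeff_pow_of_order_eq_neg_two (hX : X.order = -2) (hX' : X.leadingCoeff = 1)
    (i : ℕ) : (X ^ i).coeff (-2 * i) = 1 := by
  have hlead : (X ^ i).leadingCoeff = 1 := by
    induction i with
    | zero => simp
    | succ i ih => rw [pow_succ, leadingCoeff_mul, ih, hX', one_mul]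
  rw [leadingCoeff_eq, order_pow, hX] at hlead
  simpa [mul_comm] using hlead

lemma coeff_eval₂_of_order_eq_neg_two (hX : X.order = -2) (hX' : X.leadingCoeff = 1)
    (p : Polynomial K) {m : ℤ} (hm : m ≤ -2 * p.natDegree) :
    (p.eval₂ C X).coeff m = if m = -2 * p.natDegree then p.leadingCoeff else 0 := by
  rw [Polynomial.eval₂_eq_sum_range, coeff_sum, Finset.sum_range_succ,
    Finset.sum_eq_zero, zero_add]
  · rw [C_mul_eq_smul, coeff_smul, smul_eq_mul]
    split_ifs with h
    · rw [h, coeff_pow_of_order_eq_neg_two hX hX', mul_one, Polynomial.leadingCoeff]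
    · rw [coeff_eq_zero_of_lt_order, mul_zero]
      rw [order_pow, hX, nsmul_eq_mul]
      lia
  · intro i hi
    rw [C_mul_eq_smul, coeff_smul, coeff_eq_zero_of_lt_order, smul_zero]
    rw [order_pow, hX, nsmul_eq_mul]
    have := Finset.mem_range.1 hi
    lia

lemma coeff_eval₂_neg_two_mul_natDegree (hX : X.order = -2) (hX' : X.leadingCoeff = 1)
    (p : Polynomial K) :
    (p.eval₂ C X).coeff (-2 * p.natDegree) = p.leadingCoeff := by
  rw [coeff_eval₂_of_order_eq_neg_two hX hX' p le_rfl, if_pos rfl]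

lemma eval₂_ne_zero_of_order_eq_neg_two (hX : X.order = -2) (hX' : X.leadingCoeff = 1)
    {p : Polynomial K} (hp : p ≠ 0) : p.eval₂ C X ≠ 0 :=
  ne_zero_of_coeff_ne_zero (g := -2 * p.natDegree) <| by
    rwa [coeff_eval₂_neg_two_mul_natDegree hX hX', Polynomial.leadingCoeff_ne_zero]

lemma order_eval₂_of_order_eq_neg_two (hX : X.order = -2) (hX' : X.leadingCoeff = 1)
    {p : Polynomial K} (hp : p ≠ 0) :
    (p.eval₂ C X).order = -2 * p.natDegree := by
  refine le_antisymm (order_le_of_coeff_ne_zero ?_)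
    ((le_order_iff_forall (eval₂_ne_zero_of_order_eq_neg_two hX hX' hp)).2 fun j hj ↦ ?_)
  · rwa [coeff_eval₂_neg_two_mul_natDegree hX hX', Polynomial.leadingCoeff_ne_zero]
  · rw [coeff_eval₂_of_order_eq_neg_two hX hX' p hj.le, if_neg hj.ne]

end LaurentEval

/-- **Leading term of the `x`-coordinate of multiplication by `n` at infinity.**
Let `K` be a field of characteristic zero, `X Y : K((t))` Laurent series satisfying a Weierstrass
equation with `X = t⁻² + O(t⁻¹)` and `Y = -t⁻³ + O(t⁻²)`, and let `ψ n` denote the evaluation at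
`(X, Y)` of the `n`-th division polynomial of the Weierstrass curve (characterized by the standard
initial values and recurrences).  Then for every `n ≥ 1`, the Laurent series `X·ψₙ² - ψₙ₊₁·ψₙ₋₁` is nonzero of
order `-2n²` with leading coefficient `1`. -/
theorem multiplication_by_n_x_coordinate_leading_term
    {K : Type*} [Field K] [CharZero K]
    (a₁ a₂ a₃ a₄ a₆ b₂ b₄ b₆ b₈ : K)
    (hb₂ : b₂ = a₁ ^ 2 + 4 * a₂)
    (hb₄ : b₄ = 2 * a₄ + a₁ * a₃)
    (hb₆ : b₆ = a₃ ^ 2 + 4 * a₆)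
    (hb₈ : b₈ = a₁ ^ 2 * a₆ + 4 * a₂ * a₆ - a₁ * a₃ * a₄ + a₂ * a₃ ^ 2 - a₄ ^ 2)
    (T X Y : LaurentSeries K)
    (hT : T = HahnSeries.single (1 : ℤ) (1 : K))
    (hW : Y ^ 2 + C a₁ * X * Y + C a₃ * Y
        = X ^ 3 + C a₂ * X ^ 2 + C a₄ * X + C a₆)
    (hX : ∃ f : PowerSeries K, T ^ 2 * X = 1 + T * (f : LaurentSeries K))
    (hY : ∃ g : PowerSeries K, T ^ 3 * Y = -1 + T * (g : LaurentSeries K))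
    (ψ : ℕ → LaurentSeries K)
    (hψ₀ : ψ 0 = 0)
    (hψ₁ : ψ 1 = 1)
    (hψ₂ : ψ 2 = 2 * Y + C a₁ * X + C a₃)
    (hψ₃ : ψ 3 = 3 * X ^ 4 + C b₂ * X ^ 3 + 3 * C b₄ * X ^ 2 + 3 * C b₆ * X + C b₈)
    (hψ₄ : ψ 4 = ψ 2 * (2 * X ^ 6 + C b₂ * X ^ 5 + 5 * C b₄ * X ^ 4 + 10 * C b₆ * X ^ 3
        + 10 * C b₈ * X ^ 2 + C (b₂ * b₈ - b₄ * b₆) * X + C (b₄ * b₈ - b₆ ^ 2)))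
    (hψodd : ∀ m : ℕ, 2 ≤ m →
        ψ (2 * m + 1) = ψ (m + 2) * ψ m ^ 3 - ψ (m - 1) * ψ (m + 1) ^ 3)
    (hψeven : ∀ m : ℕ, 2 ≤ m →
        ψ 2 * ψ (2 * m) = ψ m * (ψ (m + 2) * ψ (m - 1) ^ 2 - ψ (m - 2) * ψ (m + 1) ^ 2)) :
    ∀ n : ℕ, 1 ≤ n →
      X * ψ n ^ 2 - ψ (n + 1) * ψ (n - 1) ≠ 0 ∧
      (X * ψ n ^ 2 - ψ (n + 1) * ψ (n - 1)).order = -2 * (n : ℤ) ^ 2 ∧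
      (X * ψ n ^ 2 - ψ (n + 1) * ψ (n - 1)).coeff
          ((X * ψ n ^ 2 - ψ (n + 1) * ψ (n - 1)).order) = 1 := by
  subst hT
  obtain ⟨f, hf⟩ := hX
  obtain ⟨hord, hlead⟩ := order_eq_neg_two_of_single_sq_mul_eq hf
  let W : WeierstrassCurve K := ⟨a₁, a₂, a₃, a₄, a₆⟩
  obtain rfl : b₂ = W.b₂ := hb₂
  obtain rfl : b₄ = W.b₄ := hb₄
  obtain rfl : b₆ = W.b₆ := hb₆
  obtain rfl : b₈ = W.b₈ := hb₈
  let ev : Polynomial K →+* LaurentSeries K := Polynomial.eval₂RingHom C X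
  have hev (a : K) : ev (Polynomial.C a) = C a := Polynomial.eval₂_C ..
  have hevX : ev Polynomial.X = X := Polynomial.eval₂_X ..
  have hsq : ψ 2 ^ 2 = ev W.Ψ₂Sq := by
    simp only [WeierstrassCurve.Ψ₂Sq, map_add, map_mul, map_pow, hev, hevX, hψ₂,
      WeierstrassCurve.b₂, WeierstrassCurve.b₄, WeierstrassCurve.b₆, map_ofNat, W]
    linear_combination 4 * hW
  have h2 : ψ 2 ≠ 0 := fun h ↦
    eval₂_ne_zero_of_order_eq_neg_two hord hlead (W.Ψ₂Sq_ne_zero (by norm_num))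
      (hsq.symm.trans (by simp [h]))
  have hψ (n : ℕ) : ψ n = ev (W.preΨ' n) * if Even n then ψ 2 else 1 := by
    rw [eq_preNormEDS'_mul_of_rec (c := ev W.Ψ₃) (d := ev W.preΨ₄) hψ₀ hψ₁ h2 ?_ ?_ hψodd hψeven n,
      WeierstrassCurve.preΨ', map_preNormEDS', map_pow, ← hsq, ← pow_mul]
    · simp only [hψ₃, WeierstrassCurve.Ψ₃, map_add, map_mul, map_pow, hev, hevX, map_ofNat]
    · simp only [hψ₄, WeierstrassCurve.preΨ₄, map_add, map_mul, map_pow, hev, hevX, map_ofNat]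
  have hφ (n : ℕ) : X * ψ (n + 1) ^ 2 - ψ (n + 1 + 1) * ψ n = ev (W.Φ ((n + 1 : ℕ) : ℤ)) := by
    rw [Nat.cast_succ, W.Φ_ofNat, hψ n, hψ (n + 1), hψ (n + 1 + 1)]
    by_cases hn : Even n <;>
      simp only [hn, Nat.even_add_one, not_true, not_false_iff, if_true, if_false, map_sub,
        map_mul, map_pow, map_one, hevX, ← hsq] <;> ring
  intro n hn
  obtain ⟨n, rfl⟩ := Nat.exists_eq_add_of_le' hn
  have horder := order_eval₂_of_order_eq_neg_two hord hlead (W.Φ_ne_zero ((n + 1 : ℕ) : ℤ))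
  have hcoeff := coeff_eval₂_neg_two_mul_natDegree hord hlead (W.Φ ((n + 1 : ℕ) : ℤ))
  rw [← horder, W.leadingCoeff_Φ] at hcoeff
  rw [W.natDegree_Φ, Int.natAbs_natCast, Nat.cast_pow] at horder
  rw [Nat.add_sub_cancel, hφ]
  exact ⟨eval₂_ne_zero_of_order_eq_neg_two hord hlead (W.Φ_ne_zero _), horder, hcoeff⟩
end

section
/- Let X′ ∈ K((t)) denote the formal derivative of X with respect to t. Then 2Y + a₁X + a₃ ≠ 0 and the Laurent series X′/(2Y + a₁X + a₃) lies in 1 + tK[[t]]. (This expresses that the invariant differential ω = dx/(2y + a₁x + a₃) has expansion ω = (1 + O(t))·dt at the point at infinity; in particular the residue of t⁻¹ω at infinity equals 1.) -/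
open HahnSeries

/-- A Laurent series whose coefficients of negative index vanish is a power series. -/
theorem LaurentSeries.eq_coe_mk_of_coeff {R : Type*} [Semiring R] (F : LaurentSeries R)
    (c : ℕ → R) (hneg : ∀ n : ℤ, n < 0 → F.coeff n = 0) (hc : ∀ n : ℕ, F.coeff n = c n) :
    F = ((PowerSeries.mk c : PowerSeries R) : LaurentSeries R) := by
  ext n
  rw [PowerSeries.coeff_coe]
  split_ifs with hn
  · exact hneg n hn
  · obtain ⟨m, rfl⟩ := Int.eq_ofNat_of_zero_le (not_lt.mp hn)
    simp [hc]

/-- The formal derivative of `t⁻² u`, with `u` a power series, is `t⁻³` times the power series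
with coefficients `(n - 2) uₙ`. -/
theorem LaurentSeries.single_pow_three_mul_derivative {R : Type*} [CommRing R]
    (X X' : LaurentSeries R) (u : PowerSeries R)
    (hX : single (1 : ℤ) (1 : R) ^ 2 * X = (u : LaurentSeries R))
    (hX' : ∀ n : ℤ, X'.coeff n = ((n + 1 : ℤ) : R) * X.coeff (n + 1)) :
    single (1 : ℤ) (1 : R) ^ 3 * X' =
      ((PowerSeries.mk fun n => ((n : R) - 2) * PowerSeries.coeff n u : PowerSeries R) :
        LaurentSeries R) := by
  have hcoeff (n : ℤ) : (single (1 : ℤ) (1 : R) ^ 3 * X').coeff n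
      = ((n - 2 : ℤ) : R) * (u : LaurentSeries R).coeff n := by
    have h3 : (single (1 : ℤ) (1 : R) ^ 3 * X').coeff n = X'.coeff (n - 3) := by
      simpa [single_pow] using coeff_single_mul_add (r := (1 : R)) (x := X') (a := n - 3) (b := 3)
    have h2 : (single (1 : ℤ) (1 : R) ^ 2 * X).coeff n = X.coeff (n - 2) := by
      simpa [single_pow] using coeff_single_mul_add (r := (1 : R)) (x := X) (a := n - 2) (b := 2)
    rw [h3, hX', ← hX, h2, show n - 3 + 1 = n - 2 by ring]
  refine LaurentSeries.eq_coe_mk_of_coeff _ _ (fun n hn => ?_) (fun n => ?_)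
  · rw [hcoeff, PowerSeries.coeff_coe, if_pos hn, mul_zero]
  · rw [hcoeff, LaurentSeries.coeff_coe_powerSeries]
    push_cast
    rfl

/-- **Expansion of the invariant differential at infinity.**
Let `K` be a field of characteristic zero and `X Y : K((t))` Laurent series satisfying a
Weierstrass equation with `X = t⁻² + O(t⁻¹)` and `Y = -t⁻³ + O(t⁻²)`.  Let `X'` denote the
formal derivative of `X` with respect to `t` (characterized coefficientwise).  Then
`2Y + a₁X + a₃ ≠ 0` and `X' / (2Y + a₁X + a₃) ∈ 1 + t·K⟦t⟧`; i.e. the invariant differential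
`ω = dx/(2y + a₁x + a₃)` satisfies `ω = (1 + O(t))·dt` at infinity. -/
theorem invariant_differential_expansion_at_infinity
    {K : Type*} [Field K] [CharZero K]
    (a₁ a₂ a₃ a₄ a₆ : K)
    (T X Y : LaurentSeries K)
    (hT : T = HahnSeries.single (1 : ℤ) (1 : K))
    (hW : Y ^ 2 + C a₁ * X * Y + C a₃ * Y
        = X ^ 3 + C a₂ * X ^ 2 + C a₄ * X + C a₆)
    (hX : ∃ f : PowerSeries K, T ^ 2 * X = 1 + T * (f : LaurentSeries K))
    (hY : ∃ g : PowerSeries K, T ^ 3 * Y = -1 + T * (g : LaurentSeries K))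
    (X' : LaurentSeries K)
    (hX' : ∀ n : ℤ, X'.coeff n = ((n + 1 : ℤ) : K) * X.coeff (n + 1)) :
    2 * Y + C a₁ * X + C a₃ ≠ 0 ∧
      ∃ f : PowerSeries K,
        X' / (2 * Y + C a₁ * X + C a₃) = 1 + T * (f : LaurentSeries K) := by
  obtain ⟨f, hf⟩ := hX
  obtain ⟨g, hg⟩ := hY
  have hTX : T = ((PowerSeries.X : PowerSeries K) : LaurentSeries K) := by
    rw [hT, PowerSeries.coe_X]
  have hT0 : T ≠ 0 := by
    rw [hT]
    exact single_ne_zero one_ne_zero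
  set u : PowerSeries K := 1 + PowerSeries.X * f with hu
  have hXu : T ^ 2 * X = (u : LaurentSeries K) := by
    rw [hf, hu, hTX, PowerSeries.coe_add, PowerSeries.coe_mul, PowerSeries.coe_one]
  obtain ⟨w, hw, hw0⟩ : ∃ w : PowerSeries K, T ^ 3 * X' = (w : LaurentSeries K) ∧
      PowerSeries.constantCoeff w = -2 := by
    refine ⟨_, hT ▸ LaurentSeries.single_pow_three_mul_derivative X X' u (hT ▸ hXu) hX', ?_⟩
    rw [← PowerSeries.coeff_zero_eq_constantCoeff_apply, PowerSeries.coeff_mk]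
    simp [hu]
  obtain ⟨v, hv, hv0⟩ : ∃ v : PowerSeries K,
      T ^ 3 * (2 * Y + C a₁ * X + C a₃) = (v : LaurentSeries K) ∧
      PowerSeries.constantCoeff v = -2 := by
    refine ⟨(-1 + PowerSeries.X * g) + (-1 + PowerSeries.X * g)
      + PowerSeries.C a₁ * PowerSeries.X * u + PowerSeries.C a₃ * PowerSeries.X ^ 3, ?_, ?_⟩
    · simp only [PowerSeries.coe_add, PowerSeries.coe_mul, PowerSeries.coe_neg,
        PowerSeries.coe_one, PowerSeries.coe_C, PowerSeries.coe_pow, ← hXu, ← hTX]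
      linear_combination 2 * hg
    · simp
      norm_num
  have hv_ne : PowerSeries.constantCoeff v ≠ 0 := by simp [hv0]
  have hD : 2 * Y + C a₁ * X + C a₃ ≠ 0 := by
    intro h
    rw [h, mul_zero] at hv
    have : v = 0 := HahnSeries.ofPowerSeries_injective (Γ := ℤ) (by rw [← hv, map_zero])
    simp [this] at hv_ne
  refine ⟨hD, ?_⟩
  obtain ⟨q, hq⟩ : PowerSeries.X ∣ w * v⁻¹ - 1 := by
    rw [PowerSeries.X_dvd_iff]
    simp [hw0, hv0]
  have hwv : w = (1 + PowerSeries.X * q) * v := by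
    rw [← hq, add_sub_cancel, mul_assoc, PowerSeries.inv_mul_cancel v hv_ne, mul_one]
  refine ⟨q, ?_⟩
  rw [div_eq_iff hD]
  apply mul_left_cancel₀ (pow_ne_zero 3 hT0)
  rw [hw, hwv, PowerSeries.coe_mul, ← hv, PowerSeries.coe_add, PowerSeries.coe_mul,
    PowerSeries.coe_one, ← hTX]
  ring
end

section
/- Define λ := (3X² + 2a₂X + a₄ − a₁Y)/(2Y + a₁X + a₃) ∈ K((t)) (the denominator is nonzero), X₂ := λ² + a₁λ − a₂ − 2X, and Y₂ := λ(X − X₂) − Y − a₁X₂ − a₃, the coordinates of the double of the point (X,Y) under the elliptic-curve addition formulas over the field K((t)). Then X₂ is nonzero of order −2 with leading coefficient 1/4, Y₂ is nonzero of order −3 with leading coefficient −1/8, and −X₂/Y₂ ∈ 2t + t²K[[t]]. (This is the statement that the pullback [2]*t of the local parameter t = −x/y under the duplication map has Laurent expansion 2t + O(t²) at the point at infinity.) -/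
open HahnSeries

/-- A Laurent series `F` such that `tⁿF` is a power series with constant coefficient `c ≠ 0`
is nonzero of order `-n` with leading coefficient `c`. -/
theorem LaurentSeries.order_and_leadingCoeff_of_single_pow_mul_eq_coe
    {K : Type*} [Field K] {n : ℕ} {F : LaurentSeries K} {p : PowerSeries K} {c : K} (hc : c ≠ 0)
    (hp : PowerSeries.constantCoeff p = c)
    (h : HahnSeries.single (1 : ℤ) (1 : K) ^ n * F = (p : LaurentSeries K)) :
    F ≠ 0 ∧ F.order = -n ∧ F.coeff F.order = c := by
  have hF : F = HahnSeries.single (-n : ℤ) (1 : K) * (p : LaurentSeries K) := by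
    rw [← h, ← mul_assoc, HahnSeries.single_pow, HahnSeries.single_mul_single]
    simp
  have hcoeff : F.coeff (-n) = c := by
    have h0 := HahnSeries.coeff_single_mul_add (r := (1 : K)) (x := (p : LaurentSeries K))
      (a := 0) (b := (-n : ℤ))
    rw [zero_add, ← hF, one_mul] at h0
    rw [h0, PowerSeries.coeff_coe]
    simpa using hp
  have hne : F ≠ 0 := by
    rintro rfl
    exact hc (by simpa using hcoeff.symm)
  have hord : F.order = -n := by
    refine le_antisymm (HahnSeries.order_le_of_coeff_ne_zero (by rwa [hcoeff])) ?_
    by_contra! hlt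
    apply HahnSeries.coeff_order_eq_zero.not.mpr hne
    have h0 := HahnSeries.coeff_single_mul_add (r := (1 : K)) (x := (p : LaurentSeries K))
      (a := F.order + n) (b := (-n : ℤ))
    rw [add_neg_cancel_right, ← hF, one_mul] at h0
    rw [h0, PowerSeries.coeff_coe, if_pos (by lia)]
  exact ⟨hne, hord, by rw [hord, hcoeff]⟩

/-- **Expansion of the duplication map at infinity.**
Let `K` be a field of characteristic zero and `X Y : K((t))` Laurent series satisfying a
Weierstrass equation with `X = t⁻² + O(t⁻¹)` and `Y = -t⁻³ + O(t⁻²)`.  Define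
`λ = (3X² + 2a₂X + a₄ - a₁Y)/(2Y + a₁X + a₃)`, `X₂ = λ² + a₁λ - a₂ - 2X`, and
`Y₂ = λ(X - X₂) - Y - a₁X₂ - a₃` (the coordinates of the double of `(X, Y)` under the
elliptic-curve addition formulas over `K((t))`).  Then the denominator is nonzero, `X₂` is
nonzero of order `-2` with leading coefficient `1/4`, `Y₂` is nonzero of order `-3` with
leading coefficient `-1/8`, and `-X₂/Y₂ ∈ 2t + t²·K⟦t⟧`, i.e. the pullback `[2]*t` of the
parameter `t = -x/y` has expansion `2t + O(t²)` at infinity. -/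
theorem duplication_parameter_expansion_at_infinity
    {K : Type*} [Field K] [CharZero K]
    (a₁ a₂ a₃ a₄ a₆ : K)
    (T X Y : LaurentSeries K)
    (hT : T = HahnSeries.single (1 : ℤ) (1 : K))
    (hW : Y ^ 2 + C a₁ * X * Y + C a₃ * Y
        = X ^ 3 + C a₂ * X ^ 2 + C a₄ * X + C a₆)
    (hX : ∃ f : PowerSeries K, T ^ 2 * X = 1 + T * (f : LaurentSeries K))
    (hY : ∃ g : PowerSeries K, T ^ 3 * Y = -1 + T * (g : LaurentSeries K))
    (lam X₂ Y₂ : LaurentSeries K)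
    (hlam : lam = (3 * X ^ 2 + 2 * C a₂ * X + C a₄ - C a₁ * Y) / (2 * Y + C a₁ * X + C a₃))
    (hX₂ : X₂ = lam ^ 2 + C a₁ * lam - C a₂ - 2 * X)
    (hY₂ : Y₂ = lam * (X - X₂) - Y - C a₁ * X₂ - C a₃) :
    2 * Y + C a₁ * X + C a₃ ≠ 0 ∧
    X₂ ≠ 0 ∧ X₂.order = -2 ∧ X₂.coeff X₂.order = 1 / 4 ∧
    Y₂ ≠ 0 ∧ Y₂.order = -3 ∧ Y₂.coeff Y₂.order = -(1 / 8) ∧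
    ∃ f : PowerSeries K, -X₂ / Y₂ = 2 * T + T ^ 2 * (f : LaurentSeries K) := by
  obtain ⟨f, hf⟩ := hX
  obtain ⟨g, hg⟩ := hY
  have hT0 : T ≠ 0 := by simp [hT]
  have hTX : ((PowerSeries.X : PowerSeries K) : LaurentSeries K) = T := by
    rw [hT, PowerSeries.coe_X]
  let t : PowerSeries K := PowerSeries.X
  let x : PowerSeries K := 1 + t * f
  let y : PowerSeries K := -1 + t * g
  let d : PowerSeries K := 2 * y + PowerSeries.C a₁ * t * x + PowerSeries.C a₃ * t ^ 3
  let m : PowerSeries K := 3 * x ^ 2 + 2 * PowerSeries.C a₂ * t ^ 2 * x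
    + PowerSeries.C a₄ * t ^ 4 - PowerSeries.C a₁ * t * y
  let l : PowerSeries K := m * d⁻¹
  let x₂ : PowerSeries K := l ^ 2 + PowerSeries.C a₁ * t * l - PowerSeries.C a₂ * t ^ 2 - 2 * x
  let y₂ : PowerSeries K := l * (x - x₂) - y - PowerSeries.C a₁ * t * x₂ - PowerSeries.C a₃ * t ^ 3
  have hd0 : PowerSeries.constantCoeff d = -2 := by simp [d, x, y, t, map_ofNat]
  have hl0 : PowerSeries.constantCoeff l = -(3 / 2) := by
    simp only [l, map_mul, PowerSeries.constantCoeff_inv, hd0]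
    simp [m, x, y, t, map_ofNat]
    norm_num
  have hx₂0 : PowerSeries.constantCoeff x₂ = 1 / 4 := by
    simp only [x₂, map_sub, map_add, map_mul, map_pow, hl0]
    simp [x, t, map_ofNat]
    norm_num
  have hy₂0 : PowerSeries.constantCoeff y₂ = -(1 / 8) := by
    simp only [y₂, map_sub, map_mul, map_pow, hl0, hx₂0]
    simp [x, y, t]
    norm_num
  have hdd : d * d⁻¹ = 1 := PowerSeries.mul_inv_cancel _ (by rw [hd0]; norm_num)
  have hyy : y₂ * y₂⁻¹ = 1 := PowerSeries.mul_inv_cancel _ (by rw [hy₂0]; norm_num)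
  have hx : T ^ 2 * X = (x : LaurentSeries K) := by simp [x, t, hTX, hf]
  have hy : T ^ 3 * Y = (y : LaurentSeries K) := by simp [y, t, hTX, hg]
  have hd : T ^ 3 * (2 * Y + C a₁ * X + C a₃) = (d : LaurentSeries K) := by
    simp only [d, t, map_add, map_mul, map_pow, map_ofNat, hTX, ← hx, ← hy, PowerSeries.coe_C]
    ring
  have hm : T ^ 4 * (3 * X ^ 2 + 2 * C a₂ * X + C a₄ - C a₁ * Y) = (m : LaurentSeries K) := by
    simp only [m, t, map_sub, map_add, map_mul, map_pow, map_ofNat, hTX, ← hx, ← hy,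
      PowerSeries.coe_C]
    ring
  have hdne : 2 * Y + C a₁ * X + C a₃ ≠ 0 :=
    (LaurentSeries.order_and_leadingCoeff_of_single_pow_mul_eq_coe (by norm_num) hd0
      (hT ▸ hd)).1
  have hdl : (d : LaurentSeries K) * ((d⁻¹ : PowerSeries K) : LaurentSeries K) = 1 := by
    rw [← map_mul, hdd, map_one]
  have hl : T * lam = (l : LaurentSeries K) := by
    rw [← hd] at hdl
    simp only [l, map_mul, ← hm]
    rw [hlam, mul_div_assoc', div_eq_iff hdne]
    linear_combination
      -(T * (3 * X ^ 2 + 2 * C a₂ * X + C a₄ - C a₁ * Y)) * hdl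
  have hx₂ : T ^ 2 * X₂ = (x₂ : LaurentSeries K) := by
    simp only [x₂, t, map_sub, map_add, map_mul, map_pow, map_ofNat, hTX, ← hx, ← hl,
      PowerSeries.coe_C, hX₂]
    ring
  have hy₂ : T ^ 3 * Y₂ = (y₂ : LaurentSeries K) := by
    simp only [y₂, t, map_sub, map_mul, map_pow, hTX, ← hx, ← hy, ← hl, ← hx₂,
      PowerSeries.coe_C, hY₂]
    ring
  obtain ⟨hX₂ne, hX₂ord, hX₂lead⟩ :=
    LaurentSeries.order_and_leadingCoeff_of_single_pow_mul_eq_coe (by norm_num) hx₂0 (hT ▸ hx₂)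
  obtain ⟨hY₂ne, hY₂ord, hY₂lead⟩ :=
    LaurentSeries.order_and_leadingCoeff_of_single_pow_mul_eq_coe (by norm_num) hy₂0 (hT ▸ hy₂)
  refine ⟨hdne, hX₂ne, hX₂ord, hX₂lead, hY₂ne, hY₂ord, hY₂lead, ?_⟩
  obtain ⟨q, hq⟩ : PowerSeries.X ∣ -x₂ * y₂⁻¹ - 2 := by
    rw [PowerSeries.X_dvd_iff]
    simp only [map_sub, map_mul, map_neg, PowerSeries.constantCoeff_inv, hx₂0, hy₂0, map_ofNat]
    norm_num
  refine ⟨q, ?_⟩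
  have hq' : -x₂ = (2 + PowerSeries.X * q) * y₂ := by
    linear_combination y₂ * hq + x₂ * hyy
  have hq'' := congrArg (HahnSeries.ofPowerSeries ℤ K) hq'
  simp only [map_neg, map_mul, map_add, map_ofNat, hTX, ← hx₂, ← hy₂] at hq''
  rw [div_eq_iff hY₂ne]
  apply mul_left_cancel₀ (pow_ne_zero 2 hT0)
  linear_combination hq''
end
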